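/- For every prime two-sided ideal P of the algebra S_n, the height and co-height of P satisfy ht(P) + cht(P) = cl.Kdim(S_n) = 2n. -/

import Mathlib

set_option synthInstance.maxHeartbeats 1000000
set_option maxHeartbeats 1000000

open MvPolynomial

noncomputable section

/-- The polynomial algebra `P_n = K[x_1, …, x_n]`. -/
abbrev PolyAlg (K : Type u) [Field K] (n : ℕ) := MvPolynomial (Fin n) K

/-- `X_i` : multiplication by the variable `x_i`, as a `K`-linear endomorphism of `P_n`. -/
def Xop (K : Type u) [Field K] (n : ℕ) (i : Fin n) : Module.End K (PolyAlg K n) :=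
  LinearMap.mulLeft K (X i)

/-- `Y_i` : the left inverse of `X_i`, sending a monomial `x^α` to `x^{α - e_i}` if `α i ≥ 1`
and to `0` otherwise. -/
def Yop (K : Type u) [Field K] (n : ℕ) (i : Fin n) : Module.End K (PolyAlg K n) :=
  (basisMonomials (Fin n) K).constr K fun α =>
    if α i = 0 then 0 else monomial (α - Finsupp.single i 1) (1 : K)

/-- The algebra `S_n` of one-sided inverses of `P_n` : the subalgebra of `End_K(P_n)`
generated by `X_1, …, X_n, Y_1, …, Y_n`. -/
def SnAlg (K : Type u) [Field K] (n : ℕ) : Subalgebra K (Module.End K (PolyAlg K n)) :=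
  Algebra.adjoin K (Set.range (Xop K n) ∪ Set.range (Yop K n))

/-- `x_i` as an element of `S_n`. -/
def xS (K : Type u) [Field K] (n : ℕ) (i : Fin n) : SnAlg K n :=
  ⟨Xop K n i, Algebra.subset_adjoin (Set.mem_union_left _ ⟨i, rfl⟩)⟩

/-- `y_i` as an element of `S_n`. -/
def yS (K : Type u) [Field K] (n : ℕ) (i : Fin n) : SnAlg K n :=
  ⟨Yop K n i, Algebra.subset_adjoin (Set.mem_union_right _ ⟨i, rfl⟩)⟩

/-- The product `I*J` of two two-sided ideals: the two-sided ideal generated by all products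
`a * b` with `a ∈ I`, `b ∈ J`. -/
def tsiMul {R : Type*} [Ring R] (I J : TwoSidedIdeal R) : TwoSidedIdeal R :=
  TwoSidedIdeal.span {x | ∃ a ∈ I, ∃ b ∈ J, x = a * b}

/-- A two-sided ideal `P` of a ring is prime if it is proper and for all two-sided ideals
`I`, `J`, `I*J ⊆ P` implies `I ⊆ P` or `J ⊆ P`. -/
def tsiPrime {R : Type*} [Ring R] (P : TwoSidedIdeal R) : Prop :=
  P ≠ ⊤ ∧ ∀ I J : TwoSidedIdeal R, tsiMul I J ≤ P → I ≤ P ∨ J ≤ P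

/-- There is a strictly increasing chain of prime two-sided ideals
`f 0 ⊊ f 1 ⊊ ⋯ ⊊ f m = P` of length `m` ending at `P`. -/
def primeChainTo {R : Type*} [Ring R] (P : TwoSidedIdeal R) (m : ℕ) : Prop :=
  ∃ f : Fin (m + 1) → TwoSidedIdeal R,
    StrictMono f ∧ (∀ i, tsiPrime (f i)) ∧ f (Fin.last m) = P

/-- There is a strictly increasing chain of prime two-sided ideals
`P = f 0 ⊊ f 1 ⊊ ⋯ ⊊ f m` of length `m` starting at `P`. -/
def primeChainFrom {R : Type*} [Ring R] (P : TwoSidedIdeal R) (m : ℕ) : Prop :=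
  ∃ f : Fin (m + 1) → TwoSidedIdeal R,
    StrictMono f ∧ (∀ i, tsiPrime (f i)) ∧ f 0 = P

/-- The height of the prime two-sided ideal `P` is `h` : there is a chain of primes of length `h`
ending at `P` and every such chain has length at most `h`. -/
def heightIs {R : Type*} [Ring R] (P : TwoSidedIdeal R) (h : ℕ) : Prop :=
  primeChainTo P h ∧ ∀ m, primeChainTo P m → m ≤ h

/-- The co-height of the prime two-sided ideal `P` (the classical Krull dimension of `R/P`) is
`c` : there is a chain of primes of length `c` starting at `P` and every such chain has length
at most `c`. -/
def coheightIs {R : Type*} [Ring R] (P : TwoSidedIdeal R) (c : ℕ) : Prop :=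
  primeChainFrom P c ∧ ∀ m, primeChainFrom P m → m ≤ c

section Proof

theorem MvPolynomial.height_eq_of_isMaximal {K : Type*} [Field K] {n : ℕ}
    (M : Ideal (MvPolynomial (Fin n) K)) [hM : M.IsMaximal] : M.height = n := by
  induction n with
  | zero =>
    have e := (isEmptyRingEquiv K (Fin 0))
    have : IsField (MvPolynomial (Fin 0) K) := e.toMulEquiv.isField (Field.toIsField K)
    have hbot : M = ⊥ := by
      let := this.toField
      exact (Ideal.eq_bot_or_top M).resolve_right hM.ne_top
    simp [hbot]
  | succ n ih =>
    let e := (finSuccEquiv K n).toRingEquiv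
    let M' := M.map e
    have : M'.IsMaximal := Ideal.map_isMaximal_of_equiv e
    have hp : (M'.under (MvPolynomial (Fin n) K)).IsMaximal :=
      Polynomial.isMaximal_comap_C_of_isJacobsonRing M'
    have := Polynomial.height_eq_height_add_one (M'.under (MvPolynomial (Fin n) K)) M'
    rw [ih, e.height_map] at this
    simpa using this

/-- The quotient of a polynomial ring in `n` variables by a prime `Q` contains a polynomial ring
in at least `n - ht Q` variables. -/
theorem MvPolynomial.exists_injective_aeval_of_isPrime {K : Type*} [Field K] {n : ℕ}
    (Q : Ideal (MvPolynomial (Fin n) K)) [hQ : Q.IsPrime] :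
    ∃ d : ℕ, (n : ℕ∞) ≤ d + Q.height ∧
      ∃ g : MvPolynomial (Fin d) K →ₐ[K] MvPolynomial (Fin n) K ⧸ Q, Function.Injective g := by
  induction n with
  | zero =>
    refine ⟨0, by simp, Algebra.ofId _ _ |>.comp (isEmptyAlgEquiv K (Fin 0)).toAlgHom, ?_⟩
    exact (algebraMap K (MvPolynomial (Fin 0) K ⧸ Q)).injective.comp
      (isEmptyAlgEquiv K (Fin 0)).injective
  | succ n ih =>
    let e := finSuccEquiv K n
    let R := MvPolynomial (Fin n) K
    let Q' : Ideal (Polynomial R) := Q.map e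
    have hQ'p : Q'.IsPrime := Ideal.map_isPrime_of_equiv e
    have hht : Q'.height = Q.height := e.toRingEquiv.height_map Q
    let p : Ideal R := Q'.comap Polynomial.C
    have hp : p.IsPrime := Ideal.comap_isPrime _ _
    obtain ⟨d, hd, g, hg⟩ := ih p
    have hle : p.map Polynomial.C ≤ Q' := Ideal.map_comap_le
    let qe : (MvPolynomial (Fin (n + 1)) K ⧸ Q) ≃ₐ[K] (Polynomial R ⧸ Q') :=
      Ideal.quotientEquivAlg Q Q' e rfl
    have hphe : p.height ≤ (p.map Polynomial.C).height := by
      have : (p.map (Polynomial.C : R →+* _)).LiesOver p := ⟨by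
        ext x
        simp only [Ideal.under, Ideal.mem_comap]
        rw [Ideal.mem_map_C_iff]
        refine ⟨fun h i => ?_, fun h => by simpa using h 0⟩
        rw [Polynomial.algebraMap_eq, Polynomial.coeff_C]
        split_ifs <;> simp [h]⟩
      rw [Ideal.height_eq_height_add_of_liesOver_of_hasGoingDown p (p.map Polynomial.C)]
      exact le_self_add
    rcases hle.eq_or_lt with heq | hlt
    · refine ⟨d + 1, ?_, ?_⟩
      · rw [← hht, ← heq]
        push_cast
        calc (n : ℕ∞) + 1 ≤ d + p.height + 1 := by gcongr
          _ ≤ d + (p.map Polynomial.C).height + 1 := by gcongr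
          _ = _ := by ring
      · let pe := (Ideal.polynomialQuotientEquivQuotientPolynomial p)
        let f1 : Polynomial (MvPolynomial (Fin d) K) →ₐ[K] Polynomial (R ⧸ p) :=
          Polynomial.mapAlgHom g
        let f2 : Polynomial (R ⧸ p) →ₐ[K] Polynomial R ⧸ Q' :=
          (Ideal.quotientEquivAlgOfEq K heq).toAlgHom.comp
            { pe.toRingHom with
              commutes' := fun r => by
                have := Ideal.polynomialQuotientEquivQuotientPolynomial_map_mk p
                  (Polynomial.C (C r))
                rw [Polynomial.map_C] at this
                exact this }
        refine ⟨(qe.symm.toAlgHom.comp f2).comp (f1.comp (finSuccEquiv K d).toAlgHom), ?_⟩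
        refine (qe.symm.injective.comp
          ((Ideal.quotientEquivAlgOfEq K heq).injective.comp pe.injective)).comp ?_
        exact (Polynomial.map_injective g.toRingHom hg).comp (finSuccEquiv K d).injective
    · refine ⟨d, ?_, ?_⟩
      · rw [← hht]
        have h1 := Ideal.height_add_one_le_of_lt_of_isPrime hlt
        have h2 : p.height + 1 ≤ Q'.height := le_trans (by gcongr) h1
        push_cast
        calc (n : ℕ∞) + 1 ≤ d + p.height + 1 := by gcongr
          _ = d + (p.height + 1) := by ring
          _ ≤ _ := by gcongr
      · let f : R ⧸ p →ₐ[K] Polynomial R ⧸ Q' :=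
          Ideal.quotientMapₐ Q' (Polynomial.CAlgHom (R := K) (A := R)) le_rfl
        have hf : Function.Injective f := Ideal.quotientMap_injective
        exact ⟨qe.symm.toAlgHom.comp (f.comp g), qe.symm.injective.comp (hf.comp hg)⟩

theorem MvPolynomial.le_of_injective_of_isIntegral {K B : Type u} [Field K] [CommRing B]
    [IsDomain B] [Algebra K B] {d e : ℕ} (g : MvPolynomial (Fin d) K →ₐ[K] B)
    (hg : Function.Injective g) (f : MvPolynomial (Fin e) K →ₐ[K] B)
    (hf : Function.Injective f) (hfi : f.IsIntegral) : d ≤ e := by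
  algebraize [f.toRingHom]
  have : IsScalarTower K (MvPolynomial (Fin e) K) B := IsScalarTower.of_algebraMap_eq' 
    f.comp_algebraMap.symm
  have : Algebra.IsIntegral (MvPolynomial (Fin e) K) B := ⟨hfi⟩
  have : FaithfulSMul (MvPolynomial (Fin e) K) B :=
    (faithfulSMul_iff_algebraMap_injective _ _).mpr hf
  have h1 := trdeg_add_eq K (MvPolynomial (Fin e) K) (A := B)
  have h2 := trdeg_le_of_injective g hg
  rw [trdeg_eq_zero (R := MvPolynomial (Fin e) K) (A := B), add_zero] at h1
  rw [← h1, MvPolynomial.trdeg_of_isDomain, MvPolynomial.trdeg_of_isDomain] at h2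
  simpa using h2

theorem Ideal.exists_isMaximal_notMem {B : Type*} [CommRing B] [IsJacobsonRing B]
    (P : Ideal B) [hP : P.IsPrime] {g : B} (hg : g ∉ P) :
    ∃ M : Ideal B, M.IsMaximal ∧ P ≤ M ∧ g ∉ M := by
  have h := IsJacobsonRing.out ‹IsJacobsonRing B› (Ideal.IsPrime.isRadical hP)
  rw [← h, Ideal.jacobson, Ideal.mem_sInf] at hg
  push Not at hg
  obtain ⟨M, ⟨h1, h2⟩, h3⟩ := hg
  exact ⟨M, h2, h1, h3⟩

/-- Above a prime `Q` avoiding `g`, there is a chain of primes avoiding `g` of length at least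
`n - ht Q`. -/
theorem MvPolynomial.exists_ltSeries_notMem {K : Type u} [Field K] {n : ℕ}
    (Q : Ideal (MvPolynomial (Fin n) K)) [hQ : Q.IsPrime] {g : MvPolynomial (Fin n) K}
    (hg : g ∉ Q) :
    ∃ s : LTSeries (PrimeSpectrum (MvPolynomial (Fin n) K)), s.head.asIdeal = Q ∧
      g ∉ s.last.asIdeal ∧ (n : ℕ∞) ≤ s.length + Q.height := by
  let B := MvPolynomial (Fin n) K ⧸ Q
  obtain ⟨d, hd, φ, hφ⟩ := exists_injective_aeval_of_isPrime Q
  obtain ⟨e, -, f, hf, hfi⟩ := exists_integral_inj_algHom_of_quotient Q hQ.ne_top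
  have hde := le_of_injective_of_isIntegral φ hφ f hf hfi
  algebraize [f.toRingHom]
  have : Algebra.IsIntegral (MvPolynomial (Fin e) K) B := ⟨hfi⟩
  have hgB : (Ideal.Quotient.mk Q g) ≠ 0 := by rwa [Ne, Ideal.Quotient.eq_zero_iff_mem]
  obtain ⟨h, hh, h0⟩ := Submodule.exists_mem_ne_zero_of_ne_bot
    (Ideal.comap_ne_bot_of_integral_mem (R := MvPolynomial (Fin e) K) hgB
      (Ideal.mem_span_singleton_self _) (Algebra.IsIntegral.isIntegral _))
  obtain ⟨M, hM, -, hhM⟩ := Ideal.exists_isMaximal_notMem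
    (⊥ : Ideal (MvPolynomial (Fin e) K)) (g := h) (by simpa using h0)
  obtain ⟨l, hl, hlen⟩ := M.exists_ltSeries_length_eq_height
  rw [height_eq_of_isMaximal] at hlen
  have hlbot : l.head.asIdeal = ⊥ := by
    by_contra hne
    have hlt : (⟨⊥, Ideal.isPrime_bot⟩ : PrimeSpectrum (MvPolynomial (Fin e) K)) < l.head :=
      bot_lt_iff_ne_bot (α := Ideal (MvPolynomial (Fin e) K)) |>.mpr hne
    have h1 := Order.length_le_height (p := l.cons _ hlt) (x := ⟨M, hM.isPrime⟩) (by simp [hl])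
    rw [← PrimeSpectrum.height_eq_orderHeight, height_eq_of_isMaximal] at h1
    simp only [RelSeries.cons_length, ← hlen] at h1
    norm_cast at h1
    omega
  have : (⊥ : Ideal B).LiesOver l.head.asIdeal := ⟨by
    rw [hlbot]; exact (Ideal.comap_bot_of_injective _ hf).symm⟩
  obtain ⟨L, hLl, hLh, hLm⟩ := Ideal.exists_ltSeries_of_hasGoingUp l (⊥ : Ideal B)
  refine ⟨L.map (PrimeSpectrum.comap (Ideal.Quotient.mk Q))
    (RingHom.strictMono_comap_of_surjective Ideal.Quotient.mk_surjective), ?_, ?_, ?_⟩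
  · rw [LTSeries.head_map, hLh]
    simp only [PrimeSpectrum.comap, ← RingHom.ker_eq_comap_bot]
    exact Ideal.mk_ker
  · rw [LTSeries.last_map]
    intro hgL
    apply hhM
    have : PrimeSpectrum.comap (algebraMap _ B) L.last = l.last := by
      rw [← RelSeries.getLast_toList, ← RelSeries.getLast_toList]
      simp only [← hLm, List.getLast_map]
    have h3 : M = l.last.asIdeal := by rw [hl]
    rw [h3, ← this]
    have : Ideal.span {Ideal.Quotient.mk Q g} ≤ L.last.asIdeal := by
      rw [Ideal.span_singleton_le_iff_mem]; exact hgL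
    exact this hh
  · refine hd.trans ?_
    have : ((L.map (PrimeSpectrum.comap (Ideal.Quotient.mk Q))
      (RingHom.strictMono_comap_of_surjective Ideal.Quotient.mk_surjective)).length : ℕ∞) = e := by
      simp [hLl, ← hlen]
    rw [this]
    gcongr

theorem MvPolynomial.isPrime_map_C {R σ : Type*} [CommRing R] (q : Ideal R) [q.IsPrime] :
    (q.map (C : R →+* MvPolynomial σ R)).IsPrime := by
  rw [← Ideal.Quotient.isDomain_iff_prime]
  exact (quotientEquivQuotientMvPolynomial (σ := σ) q).symm.toMulEquiv.isDomain _

theorem MvPolynomial.comap_map_C {R σ : Type*} [CommRing R] (q : Ideal R) :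
    (q.map (C : R →+* MvPolynomial σ R)).comap C = q := by
  classical
  ext x
  simp only [Ideal.mem_comap, mem_map_C_iff, coeff_C]
  refine ⟨fun h => by simpa using h 0, fun h m => ?_⟩
  split_ifs <;> simp [h]

theorem MvPolynomial.height_map_C {R σ : Type*} [CommRing R] [IsNoetherianRing R] [Finite σ]
    (q : Ideal R) [q.IsPrime] : (q.map (C : R →+* MvPolynomial σ R)).height = q.height := by
  have := isPrime_map_C (σ := σ) q
  have : (q.map (C : R →+* MvPolynomial σ R)).LiesOver q := ⟨(comap_map_C q).symm⟩
  have : Nontrivial (MvPolynomial σ R ⧸ q.map (algebraMap R (MvPolynomial σ R))) :=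
    Ideal.Quotient.nontrivial_iff.mpr (Ideal.IsPrime.ne_top ‹(q.map C).IsPrime›)
  rw [Ideal.height_eq_height_add_of_liesOver_of_hasGoingDown q
    (q.map (C : R →+* MvPolynomial σ R)), ← algebraMap_eq, Ideal.map_quotient_self,
    Ideal.height_bot, add_zero]

variable {K : Type u} [Field K] {n : ℕ}

/-- The inclusion `K[x_i : i ∈ I] → K[x_1, …, x_n]`. -/
def inclPoly (K : Type u) [Field K] {n : ℕ} (I : Finset (Fin n)) :
    MvPolynomial {i // i ∈ I} K →ₐ[K] PolyAlg K n :=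
  rename (Subtype.val : {i // i ∈ I} → Fin n)

/-- The ring `K[x_1, …, x_n]` as a polynomial ring over `K[x_i : i ∈ I]`. -/
def splitEquiv (K : Type u) [Field K] {n : ℕ} (I : Finset (Fin n)) :
    PolyAlg K n ≃ₐ[K] MvPolynomial {i // i ∉ I} (MvPolynomial {i // i ∈ I} K) :=
  (renameEquiv K ((Equiv.sumComm _ _).trans (Equiv.sumCompl (· ∈ I))).symm).trans
    (sumAlgEquiv K {i // i ∉ I} {i // i ∈ I})

theorem splitEquiv_inclPoly (I : Finset (Fin n)) (f : MvPolynomial {i // i ∈ I} K) :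
    splitEquiv K I (inclPoly K I f) = C f := by
  have h := DFunLike.congr_fun (sumAlgEquiv_comp_rename_inr K {i // i ∉ I} {i // i ∈ I}) f
  rw [← algebraMap_eq]
  refine Eq.trans ?_ h
  simp only [splitEquiv, inclPoly, AlgEquiv.trans_apply, renameEquiv_apply, rename_rename,
    AlgHom.comp_apply, AlgEquiv.toAlgHom_apply]
  congr 2
  congr 1
  ext i
  simp

theorem map_splitEquiv (I : Finset (Fin n)) (q : Ideal (MvPolynomial {i // i ∈ I} K)) :
    (q.map (inclPoly K I)).map (splitEquiv K I) = q.map C := by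
  have : (RingHomClass.toRingHom (splitEquiv K I)).comp (RingHomClass.toRingHom (inclPoly K I)) =
      (C : _ →+* MvPolynomial {i // i ∉ I} (MvPolynomial {i // i ∈ I} K)) :=
    RingHom.ext fun f => splitEquiv_inclPoly I f
  rw [← this, ← Ideal.map_map]
  rfl

theorem map_inclPoly_eq (I : Finset (Fin n)) (q : Ideal (MvPolynomial {i // i ∈ I} K)) :
    q.map (inclPoly K I) = (q.map C).comap (splitEquiv K I) := by
  rw [← map_splitEquiv, Ideal.comap_map_of_bijective _ (splitEquiv K I).bijective]

theorem isPrime_map_inclPoly (I : Finset (Fin n)) (q : Ideal (MvPolynomial {i // i ∈ I} K))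
    [q.IsPrime] : (q.map (inclPoly K I)).IsPrime := by
  rw [map_inclPoly_eq]
  have := isPrime_map_C (σ := {i // i ∉ I}) q
  exact Ideal.comap_isPrime _ _

theorem comap_map_inclPoly (I : Finset (Fin n)) (q : Ideal (MvPolynomial {i // i ∈ I} K)) :
    (q.map (inclPoly K I)).comap (inclPoly K I) = q := by
  conv_rhs => rw [← comap_map_C (σ := {i // i ∉ I}) q]
  rw [map_inclPoly_eq]
  ext f
  simp only [Ideal.mem_comap, splitEquiv_inclPoly]

theorem height_map_inclPoly (I : Finset (Fin n)) (q : Ideal (MvPolynomial {i // i ∈ I} K))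
    [q.IsPrime] : (q.map (inclPoly K I)).height = q.height := by
  rw [← height_map_C (σ := {i // i ∉ I}) q, ← map_splitEquiv]
  exact ((splitEquiv K I).toRingEquiv.height_map _).symm

theorem coeff_Yop (j : Fin n) (f : PolyAlg K n) (m : Fin n →₀ ℕ) :
    coeff m (Yop K n j f) = coeff (m + Finsupp.single j 1) f := by
  classical
  induction f using MvPolynomial.induction_on' with
  | add p q hp hq => simp only [map_add, coeff_add, hp, hq]
  | monomial α c =>
    have hα : monomial α c = c • basisMonomials (Fin n) K α := by
      simp [smul_monomial]
    rw [hα, map_smul, Yop, Module.Basis.constr_basis, coeff_smul, coeff_smul]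
    congr 1
    simp only [coe_basisMonomials, coeff_monomial]
    split_ifs with h0 h1 h1
    · simp [h1] at h0
    · simp
    · rw [h1, coeff_monomial, if_pos (by simp)]
    · rw [coeff_monomial, if_neg]
      rintro rfl
      apply h1
      ext i
      by_cases hij : j = i
      · subst hij
        simp
        omega
      · simp [hij]

theorem Yop_X_mul (j : Fin n) (f : PolyAlg K n) : Yop K n j (X j * f) = f := by
  ext m
  rw [coeff_Yop, add_comm, coeff_X_mul]

/-- The evaluation `x_j ↦ 0` for `j ∈ J`. -/
def epsHom (K : Type u) [Field K] {n : ℕ} (J : Finset (Fin n)) : PolyAlg K n →ₐ[K] PolyAlg K n :=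
  aeval fun i => if i ∈ J then 0 else X i

theorem epsHom_X (J : Finset (Fin n)) (i : Fin n) :
    epsHom K J (X i) = if i ∈ J then 0 else X i := by
  simp [epsHom]

theorem epsHom_empty : epsHom K (∅ : Finset (Fin n)) = AlgHom.id K _ := by
  ext i
  simp [epsHom_X]

theorem epsHom_insert (j : Fin n) (J : Finset (Fin n)) :
    epsHom K (insert j J) = (epsHom K {j}).comp (epsHom K J) := by
  ext1 i
  simp only [epsHom_X, AlgHom.comp_apply, Finset.mem_insert]
  split_ifs with h1 h2 h2
  · rw [map_zero]
  · rw [epsHom_X, if_pos (by simp_all)]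
  · rw [map_zero]
    tauto
  · rw [epsHom_X, if_neg (by simp_all)]

theorem Yop_C (j : Fin n) (c : K) : Yop K n j (C c) = 0 := by
  classical
  ext m
  rw [coeff_Yop, coeff_C, if_neg, coeff_zero]
  intro h
  have := DFunLike.congr_fun h j
  simp at this

theorem Yop_X_mul_of_ne {i j : Fin n} (h : i ≠ j) (f : PolyAlg K n) :
    Yop K n j (X i * f) = X i * Yop K n j f := by
  classical
  ext m
  rw [coeff_Yop, coeff_X_mul', coeff_X_mul', coeff_Yop]
  have : i ∈ (m + Finsupp.single j 1).support ↔ i ∈ m.support := by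
    simp [h.symm]
  simp only [this]
  split_ifs with hi
  · congr 1
    ext k
    by_cases hik : i = k
    · subst hik; simp [h.symm]
    · simp [Finsupp.single_apply, hik]
  · rfl

theorem sub_X_mul_Yop (j : Fin n) (f : PolyAlg K n) :
    f - X j * Yop K n j f = epsHom K {j} f := by
  induction f using MvPolynomial.induction_on with
  | C c => simp [Yop_C, epsHom]
  | add p q hp hq => rw [map_add, map_add, ← hp, ← hq]; ring
  | mul_X p i hp =>
    rw [map_mul (epsHom K {j}), epsHom_X]
    by_cases h : i = j
    · subst h
      rw [mul_comm p, Yop_X_mul]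
      simp
    · rw [mul_comm p, Yop_X_mul_of_ne h]
      simp only [Finset.mem_singleton, h, if_false, ← hp]
      ring

theorem Yop_mul (j : Fin n) (f g : PolyAlg K n) :
    Yop K n j (f * g) = Yop K n j f * g + epsHom K {j} f * Yop K n j g := by
  have hX : (X j : PolyAlg K n) ≠ 0 := X_ne_zero j
  apply mul_left_cancel₀ hX
  have h1 := sub_X_mul_Yop j (f * g)
  have h2 := sub_X_mul_Yop j f
  have h3 := sub_X_mul_Yop j g
  rw [map_mul (epsHom K {j}), ← h3] at h1
  linear_combination -h1 + g * h2 

theorem Yop_comm_Yop (i j : Fin n) (f : PolyAlg K n) :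
    Yop K n i (Yop K n j f) = Yop K n j (Yop K n i f) := by
  ext m
  simp only [coeff_Yop]
  rw [add_right_comm]

theorem Yop_epsHom_of_ne {i j : Fin n} (h : i ≠ j) (f : PolyAlg K n) :
    Yop K n j (epsHom K {i} f) = epsHom K {i} (Yop K n j f) := by
  rw [← sub_X_mul_Yop, ← sub_X_mul_Yop, map_sub, Yop_X_mul_of_ne h, Yop_comm_Yop]

theorem Yop_inclPoly_mul {I : Finset (Fin n)} {j : Fin n} (hj : j ∉ I)
    (h : MvPolynomial {i // i ∈ I} K) (f : PolyAlg K n) :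
    Yop K n j (inclPoly K I h * f) = inclPoly K I h * Yop K n j f := by
  induction h using MvPolynomial.induction_on generalizing f with
  | C c => 
    have : inclPoly K I (C c) = C c := by simp [inclPoly]
    rw [this, ← smul_eq_C_mul, ← smul_eq_C_mul, map_smul]
  | add p q hp hq => rw [map_add, add_mul, map_add, hp, hq, add_mul]
  | mul_X p i hp =>
    have hi : inclPoly K I (X i) = X i.1 := by simp [inclPoly]
    rw [map_mul (inclPoly K I), mul_assoc, hp, hi,
      Yop_X_mul_of_ne (fun h' : i.1 = j => hj (h' ▸ i.2)), mul_assoc]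

theorem epsHom_inclPoly {I J : Finset (Fin n)} (hIJ : Disjoint I J)
    (h : MvPolynomial {i // i ∈ I} K) :
    epsHom K J (inclPoly K I h) = inclPoly K I h := by
  rw [← AlgHom.comp_apply]
  congr 1
  ext1 i
  simp [inclPoly, epsHom_X, Finset.disjoint_left.mp hIJ i.2]

/-- The evaluation of a polynomial at `x_j = 0` for `j ∉ I`, as a polynomial in `x_i`, `i ∈ I`. -/
def resPoly (K : Type u) [Field K] {n : ℕ} (I : Finset (Fin n)) :
    PolyAlg K n →ₐ[K] MvPolynomial {i // i ∈ I} K :=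
  aeval fun i => if h : i ∈ I then X ⟨i, h⟩ else 0

theorem inclPoly_resPoly (I : Finset (Fin n)) (f : PolyAlg K n) :
    inclPoly K I (resPoly K I f) = epsHom K Iᶜ f := by
  rw [← AlgHom.comp_apply]
  congr 1
  ext1 i
  by_cases h : i ∈ I <;> simp [inclPoly, resPoly, epsHom_X, h]

/-- Multiplication by a polynomial, as an element of `S_n`. -/
def mS (K : Type u) [Field K] (n : ℕ) : PolyAlg K n →ₐ[K] SnAlg K n :=
  (Algebra.lmul K (PolyAlg K n)).codRestrict (SnAlg K n) fun f => by
    induction f using MvPolynomial.induction_on with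
    | C c => exact (Algebra.lmul K (PolyAlg K n)).commutes c ▸ (SnAlg K n).algebraMap_mem c
    | add p q hp hq => rw [map_add]; exact add_mem hp hq
    | mul_X p i hp =>
      rw [map_mul]
      exact mul_mem hp (xS K n i).2

@[simp] theorem mS_apply (f g : PolyAlg K n) : (mS K n f).1 g = f * g := rfl

theorem xS_eq (i : Fin n) : xS K n i = mS K n (X i) := rfl

theorem epsHom_mem (J : Finset (Fin n)) : (epsHom K J).toLinearMap ∈ SnAlg K n := by
  induction J using Finset.induction_on with
  | empty =>
    rw [epsHom_empty]
    exact one_mem _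
  | insert j J _ hJ =>
    rw [epsHom_insert, AlgHom.comp_toLinearMap, ← Module.End.mul_eq_comp]
    refine mul_mem ?_ hJ
    have : (epsHom K {j}).toLinearMap = (1 - xS K n j * yS K n j : SnAlg K n).1 :=
      LinearMap.ext fun f => (sub_X_mul_Yop j f).symm
    rw [this]
    exact Subtype.property _

/-- The evaluation `x_j ↦ 0` for `j ∈ J`, as an element of `S_n`. -/
def eS (K : Type u) [Field K] {n : ℕ} (J : Finset (Fin n)) : SnAlg K n :=
  ⟨(epsHom K J).toLinearMap, epsHom_mem J⟩

@[simp] theorem eS_apply (J : Finset (Fin n)) (f : PolyAlg K n) :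
    (eS K J).1 f = epsHom K J f := rfl

theorem SnAlg.ext {a b : SnAlg K n} (h : ∀ f, a.1 f = b.1 f) : a = b :=
  Subtype.ext (LinearMap.ext h)

theorem SnAlg.mul_apply (a b : SnAlg K n) (f : PolyAlg K n) : (a * b).1 f = a.1 (b.1 f) := rfl
theorem SnAlg.add_apply (a b : SnAlg K n) (f : PolyAlg K n) :
    (a + b).1 f = a.1 f + b.1 f := rfl
theorem yS_apply (j : Fin n) (f : PolyAlg K n) : (yS K n j).1 f = Yop K n j f := rfl
theorem SnAlg.one_apply (f : PolyAlg K n) : (1 : SnAlg K n).1 f = f := rfl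

theorem eS_singleton (j : Fin n) : eS K {j} = 1 - xS K n j * yS K n j :=
  SnAlg.ext fun f => (sub_X_mul_Yop j f).symm

theorem eS_insert (j : Fin n) (J : Finset (Fin n)) : eS K (insert j J) = eS K {j} * eS K J :=
  SnAlg.ext fun f => by simp [epsHom_insert]

theorem eS_empty : eS K (∅ : Finset (Fin n)) = 1 :=
  SnAlg.ext fun f => by simp [epsHom_empty]

theorem eS_mul_mS (J : Finset (Fin n)) (f : PolyAlg K n) :
    eS K J * mS K n f = mS K n (epsHom K J f) * eS K J :=
  SnAlg.ext fun g => by simp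

theorem yS_mul_mS (j : Fin n) (f : PolyAlg K n) :
    yS K n j * mS K n f = mS K n (Yop K n j f) + mS K n (epsHom K {j} f) * yS K n j :=
  SnAlg.ext fun g => by
    simp [yS_apply, Yop_mul]

theorem yS_mul_xS (j : Fin n) : yS K n j * xS K n j = 1 :=
  SnAlg.ext fun g => Yop_X_mul j g

/-- An induction principle for elements of `S_n`. -/
theorem SnAlg.induction {p : SnAlg K n → Prop} (hx : ∀ i, p (xS K n i)) (hy : ∀ i, p (yS K n i))
    (hc : ∀ c : K, p (algebraMap K _ c)) (hadd : ∀ a b, p a → p b → p (a + b))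
    (hmul : ∀ a b, p a → p b → p (a * b)) (a : SnAlg K n) : p a := by
  obtain ⟨a, ha⟩ := a
  induction ha using Algebra.adjoin_induction with
  | mem a h =>
    obtain ⟨i, rfl⟩ | ⟨i, rfl⟩ := h
    · exact hx i
    · exact hy i
  | algebraMap c => exact hc c
  | add a b ha hb h1 h2 => exact hadd _ _ h1 h2
  | mul a b ha hb h1 h2 => exact hmul _ _ h1 h2

/-! ### Admissible pairs and the associated ideals -/

/-- The monomial `∏_{i ∈ I} x_i`. -/
def prodX (K : Type u) [Field K] {n : ℕ} (I : Finset (Fin n)) : PolyAlg K n := ∏ i ∈ I, X i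

/-- `Q` is stable under `Y_j` for `j ∉ I`. -/
def IsStable (I : Finset (Fin n)) (Q : Ideal (PolyAlg K n)) : Prop :=
  ∀ j ∉ I, ∀ f ∈ Q, Yop K n j f ∈ Q

/-- `(I, Q)` is the pair attached to a prime ideal of `S_n`: `I` is the set of the `i` with
`e_i = 1 - x_i y_i ∈ P` and `Q` is the intersection of `P` with the polynomial ring. -/
structure IsAdmissible (I : Finset (Fin n)) (Q : Ideal (PolyAlg K n)) : Prop where
  isPrime : Q.IsPrime
  notMem : ∀ i ∈ I, X i ∉ Q
  stable : IsStable I Q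

theorem IsAdmissible.prodX_pow_notMem {I : Finset (Fin n)} {Q : Ideal (PolyAlg K n)}
    (h : IsAdmissible I Q) (N : ℕ) : prodX K I ^ N ∉ Q := by
  have := h.isPrime
  intro hN
  obtain ⟨i, hi, hiQ⟩ := (Ideal.IsPrime.prod_mem_iff (s := I)).mp
    (Ideal.IsPrime.mem_of_pow_mem this N hN)
  exact h.notMem i hi hiQ

theorem Yop_prodX_mul_of_mem {I : Finset (Fin n)} {j : Fin n} (hj : j ∈ I)
    (f : PolyAlg K n) : Yop K n j (prodX K I * f) = prodX K (I.erase j) * f := by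
  rw [prodX, ← Finset.mul_prod_erase I _ hj, mul_assoc, Yop_X_mul, prodX]

/-- On `x_I^k P_n`, the element `a` is linear over `K[x_i : i ∈ I]`. -/
def LinFrom (I : Finset (Fin n)) (a : SnAlg K n) (k : ℕ) : Prop :=
  ∀ i ∈ I, ∀ f, a.1 (X i * (prodX K I ^ k * f)) = X i * a.1 (prodX K I ^ k * f)

theorem LinFrom.mono {I : Finset (Fin n)} {a : SnAlg K n} {k l : ℕ} (h : LinFrom I a k)
    (hkl : k ≤ l) : LinFrom I a l := fun i hi f => by
  obtain ⟨m, rfl⟩ := Nat.exists_eq_add_of_le hkl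
  rw [pow_add, mul_assoc (prodX K I ^ k), h i hi]

theorem LinFrom.inclPoly_mul {I : Finset (Fin n)} {a : SnAlg K n} {k : ℕ} (h : LinFrom I a k)
    (c : MvPolynomial {i // i ∈ I} K) (f : PolyAlg K n) :
    a.1 (inclPoly K I c * (prodX K I ^ k * f)) = inclPoly K I c * a.1 (prodX K I ^ k * f) := by
  induction c using MvPolynomial.induction_on generalizing f with
  | C c =>
    have : inclPoly K I (C c) = C c := by simp [inclPoly]
    rw [this, ← smul_eq_C_mul, ← smul_eq_C_mul, map_smul]
  | add p q hp hq => rw [map_add, add_mul, map_add, hp, hq, add_mul]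
  | mul_X p i hp =>
    have hi : inclPoly K I (X i) = X i.1 := by simp [inclPoly]
    rw [map_mul (inclPoly K I), hi, mul_assoc, mul_assoc, ← h i.1 i.2,
      mul_left_comm (X i.1), hp]

theorem prodX_eq_inclPoly (I : Finset (Fin n)) :
    prodX K I = inclPoly K I (∏ i, X i) := by
  rw [map_prod, prodX, ← Finset.prod_coe_sort]
  simp [inclPoly]

theorem LinFrom.prodX_pow_mul {I : Finset (Fin n)} {a : SnAlg K n} {k : ℕ} (h : LinFrom I a k)
    (M : ℕ) (f : PolyAlg K n) :
    a.1 (prodX K I ^ (M + k) * f) = prodX K I ^ M * a.1 (prodX K I ^ k * f) := by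
  have h1 : prodX K I ^ M = inclPoly K I ((∏ i, X i) ^ M) := by
    rw [map_pow, prodX_eq_inclPoly]
  rw [h1, ← h.inclPoly_mul, ← h1]
  congr 1
  ring

theorem exists_linFrom (I : Finset (Fin n)) (a : SnAlg K n) : ∃ k, LinFrom I a k := by
  induction a using SnAlg.induction with
  | hx j => exact ⟨0, fun i _ f => mul_left_comm (X j) (X i) _⟩
  | hy j =>
    by_cases hj : j ∈ I
    · refine ⟨1, fun i hi f => ?_⟩
      rw [yS_apply, yS_apply, pow_one, mul_left_comm, Yop_prodX_mul_of_mem hj,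
        Yop_prodX_mul_of_mem hj, mul_left_comm]
    · exact ⟨0, fun i hi f => Yop_X_mul_of_ne (fun h : i = j => hj (h ▸ hi)) _⟩
  | hc c => exact ⟨0, fun i _ f => (mul_smul_comm c (X i) _).symm⟩
  | hadd a b ha hb =>
    obtain ⟨k, hk⟩ := ha
    obtain ⟨l, hl⟩ := hb
    refine ⟨k + l, fun i hi f => ?_⟩
    rw [SnAlg.add_apply, SnAlg.add_apply, (hk.mono (Nat.le_add_right k l)) i hi,
      (hl.mono (Nat.le_add_left l k)) i hi, mul_add]
  | hmul a b ha hb =>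
    obtain ⟨k, hk⟩ := ha
    obtain ⟨l, hl⟩ := hb
    refine ⟨k + l, fun i hi f => ?_⟩
    rw [SnAlg.mul_apply, SnAlg.mul_apply, (hl.mono (Nat.le_add_left l k)) i hi,
      hl.prodX_pow_mul, hk i hi]

theorem IsAdmissible.exists_apply_mem {I : Finset (Fin n)} {Q : Ideal (PolyAlg K n)}
    (h : IsAdmissible I Q) (a : SnAlg K n) :
    ∃ M, ∀ N, M ≤ N → ∀ f ∈ Q, a.1 (prodX K I ^ N * f) ∈ Q := by
  induction a using SnAlg.induction with
  | hx j => exact ⟨0, fun N _ f hf => Q.mul_mem_left _ (Q.mul_mem_left _ hf)⟩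
  | hy j =>
    by_cases hj : j ∈ I
    · refine ⟨1, fun N hN f hf => ?_⟩
      obtain ⟨N, rfl⟩ := Nat.exists_eq_add_of_le hN
      rw [yS_apply, pow_add, pow_one, mul_assoc, Yop_prodX_mul_of_mem hj]
      exact Q.mul_mem_left _ (Q.mul_mem_left _ hf)
    · exact ⟨0, fun N _ f hf => h.stable j hj _ (Q.mul_mem_left _ hf)⟩
  | hc c => exact ⟨0, fun N _ f hf => Submodule.smul_of_tower_mem Q c (Q.mul_mem_left _ hf)⟩
  | hadd a b ha hb =>
    obtain ⟨k, hk⟩ := ha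
    obtain ⟨l, hl⟩ := hb
    exact ⟨k + l, fun N hN f hf => Q.add_mem (hk N (by omega) f hf) (hl N (by omega) f hf)⟩
  | hmul a b ha hb =>
    obtain ⟨k, hk⟩ := ha
    obtain ⟨l, hl⟩ := hb
    obtain ⟨m, hm⟩ := exists_linFrom I b
    refine ⟨k + (l + m), fun N hN f hf => ?_⟩
    obtain ⟨N, rfl⟩ := Nat.exists_eq_add_of_le' hN
    rw [SnAlg.mul_apply, ← add_assoc, (hm.mono (Nat.le_add_left m l)).prodX_pow_mul]
    exact hk _ (by omega) _ (hl _ (by omega) _ hf)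

/-- The ideal of `S_n` attached to an admissible pair. -/
def pairIdeal (I : Finset (Fin n)) (Q : Ideal (PolyAlg K n)) (h : IsAdmissible I Q) :
    TwoSidedIdeal (SnAlg K n) :=
  TwoSidedIdeal.mk' {a | ∃ M, ∀ N, M ≤ N → ∀ f, a.1 (prodX K I ^ N * f) ∈ Q}
    ⟨0, fun _ _ _ => Q.zero_mem⟩
    (fun {a b} ⟨k, hk⟩ ⟨l, hl⟩ => ⟨k + l, fun N hN f =>
      Q.add_mem (hk N (by omega) f) (hl N (by omega) f)⟩)
    (fun {a} ⟨k, hk⟩ => ⟨k, fun N hN f => Q.neg_mem (hk N hN f)⟩)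
    (fun {a b} ⟨k, hk⟩ => by
      obtain ⟨l, hl⟩ := h.exists_apply_mem a
      obtain ⟨m, hm⟩ := exists_linFrom I b
      refine ⟨l + (k + m), fun N hN f => ?_⟩
      obtain ⟨N, rfl⟩ := Nat.exists_eq_add_of_le' hN
      rw [SnAlg.mul_apply, ← add_assoc, (hm.mono (Nat.le_add_left m k)).prodX_pow_mul]
      exact hl _ (by omega) _ (hk _ (by omega) _))
    (fun {a b} ⟨k, hk⟩ => by
      obtain ⟨m, hm⟩ := exists_linFrom I b
      refine ⟨k + m, fun N hN f => ?_⟩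
      obtain ⟨N, rfl⟩ := Nat.exists_eq_add_of_le' hN
      rw [SnAlg.mul_apply, ← add_assoc, hm.prodX_pow_mul]
      exact hk _ (by omega) _)

theorem mem_pairIdeal {I : Finset (Fin n)} {Q : Ideal (PolyAlg K n)} (h : IsAdmissible I Q)
    {a : SnAlg K n} :
    a ∈ pairIdeal I Q h ↔ ∃ M, ∀ N, M ≤ N → ∀ f, a.1 (prodX K I ^ N * f) ∈ Q :=
  TwoSidedIdeal.mem_mk' _ _ _ _ _ _ _

theorem tsiPrime.mem_or_mem {R : Type*} [Ring R] {P : TwoSidedIdeal R} (hP : tsiPrime P) {a b : R}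
    (h : ∀ s, a * s * b ∈ P) : a ∈ P ∨ b ∈ P := by
  have key : tsiMul (TwoSidedIdeal.span {a}) (TwoSidedIdeal.span {b}) ≤ P := by
    have h1 : ∀ u ∈ TwoSidedIdeal.span {a}, ∀ s, u * s * b ∈ P := by
      intro u hu
      let J : TwoSidedIdeal R := TwoSidedIdeal.mk' {u | ∀ s, u * s * b ∈ P}
        (fun s => by simp [P.zero_mem])
        (fun {x y} hx hy s => by rw [add_mul, add_mul]; exact P.add_mem (hx s) (hy s))
        (fun {x} hx s => by rw [neg_mul, neg_mul]; exact P.neg_mem (hx s))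
        (fun {x y} hy s => by rw [mul_assoc x, mul_assoc x]; exact P.mul_mem_left _ _ (hy s))
        (fun {x y} hx s => by rw [mul_assoc x]; exact hx _)
      have hJ : TwoSidedIdeal.span {a} ≤ J := by
        rw [TwoSidedIdeal.span_le]
        rintro _ rfl
        exact (TwoSidedIdeal.mem_mk' _ _ _ _ _ _ _).mpr h
      exact (TwoSidedIdeal.mem_mk' _ _ _ _ _ _ _).mp (hJ hu)
    rw [tsiMul, TwoSidedIdeal.span_le]
    rintro _ ⟨u, hu, v, hv, rfl⟩
    let J : TwoSidedIdeal R := TwoSidedIdeal.mk' {v | ∀ s, u * s * v ∈ P}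
      (fun s => by simp [P.zero_mem])
      (fun {x y} hx hy s => by rw [mul_add]; exact P.add_mem (hx s) (hy s))
      (fun {x} hx s => by rw [mul_neg]; exact P.neg_mem (hx s))
      (fun {x y} hy s => by rw [← mul_assoc, mul_assoc u]; exact hy _)
      (fun {x y} hx s => by rw [← mul_assoc]; exact P.mul_mem_right _ _ (hx s))
    have hJ : TwoSidedIdeal.span {b} ≤ J := by
      rw [TwoSidedIdeal.span_le]
      rintro _ rfl
      exact (TwoSidedIdeal.mem_mk' _ _ _ _ _ _ _).mpr (h1 u hu)
    have := (TwoSidedIdeal.mem_mk' _ _ _ _ _ _ _).mp (hJ hv) 1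
    rwa [mul_one] at this
  rcases hP.2 _ _ key with h | h
  · exact Or.inl (h (TwoSidedIdeal.subset_span rfl))
  · exact Or.inr (h (TwoSidedIdeal.subset_span rfl))

theorem tsiPrime_of_forall {R : Type*} [Ring R] {P : TwoSidedIdeal R} (h1 : (1 : R) ∉ P)
    (h : ∀ a b, a ∉ P → b ∉ P → ∃ s, a * s * b ∉ P) : tsiPrime P := by
  refine ⟨fun hP => h1 (hP ▸ trivial), fun I J hIJ => ?_⟩
  by_contra! hcon
  obtain ⟨a, haI, haP⟩ := SetLike.not_le_iff_exists.mp hcon.1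
  obtain ⟨b, hbJ, hbP⟩ := SetLike.not_le_iff_exists.mp hcon.2
  obtain ⟨s, hs⟩ := h a b haP hbP
  exact hs (hIJ (TwoSidedIdeal.subset_span ⟨a * s, I.mul_mem_right _ _ haI, b, hbJ, rfl⟩))

theorem tsiPrime.one_notMem {R : Type*} [Ring R] {P : TwoSidedIdeal R} (hP : tsiPrime P) :
    (1 : R) ∉ P := fun h => hP.1 <| by
  refine top_unique fun x _ => ?_
  simpa using P.mul_mem_left x 1 h

theorem IsStable.epsHom_mem {I : Finset (Fin n)} {Q : Ideal (PolyAlg K n)} (hQ : IsStable I Q)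
    {j : Fin n} (hj : j ∉ I) {f : PolyAlg K n} (hf : f ∈ Q) : epsHom K {j} f ∈ Q := by
  rw [← sub_X_mul_Yop]
  exact Q.sub_mem hf (Q.mul_mem_left _ (hQ j hj f hf))

theorem IsStable.epsHom_mem' {I : Finset (Fin n)} {Q : Ideal (PolyAlg K n)} (hQ : IsStable I Q)
    {J : Finset (Fin n)} (hJ : Disjoint I J) {f : PolyAlg K n} (hf : f ∈ Q) :
    epsHom K J f ∈ Q := by
  induction J using Finset.induction_on with
  | empty => rwa [epsHom_empty]
  | insert j J _ ih =>
    rw [Finset.disjoint_insert_right] at hJ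
    rw [epsHom_insert]
    exact hQ.epsHom_mem hJ.1 (ih hJ.2)

theorem IsStable.sub_epsHom_mem {I : Finset (Fin n)} {Q : Ideal (PolyAlg K n)} (hQ : IsStable I Q)
    {J : Finset (Fin n)} (hJ : Disjoint I J) {f : PolyAlg K n}
    (hf : ∀ j ∈ J, Yop K n j f ∈ Q) : f - epsHom K J f ∈ Q := by
  induction J using Finset.induction_on with
  | empty => simp [epsHom_empty]
  | insert j J _ ih =>
    rw [Finset.disjoint_insert_right] at hJ
    have h1 := ih hJ.2 fun k hk => hf k (Finset.mem_insert_of_mem hk)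
    have h2 : f - epsHom K {j} f ∈ Q := by
      rw [← sub_X_mul_Yop, sub_sub_cancel]
      exact Q.mul_mem_left _ (hf j (Finset.mem_insert_self j J))
    have h3 := Q.add_mem h2 (hQ.epsHom_mem hJ.1 h1)
    rwa [map_sub, sub_add_sub_cancel, ← AlgHom.comp_apply, ← epsHom_insert] at h3

/-- A polynomial outside a stable ideal `Q` can be moved, by an element of `S_n` commuting with
the `x_i`, `i ∈ I`, into `K[x_i : i ∈ I]` and outside of `Q`. -/
theorem IsStable.exists_apply_eq_inclPoly {I : Finset (Fin n)} {Q : Ideal (PolyAlg K n)}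
    (hQ : IsStable I Q) {G : PolyAlg K n} (hG : G ∉ Q) :
    ∃ (t : SnAlg K n) (c : MvPolynomial {i // i ∈ I} K), t.1 G = inclPoly K I c ∧
      inclPoly K I c ∉ Q ∧ (∀ d f, t.1 (inclPoly K I d * f) = inclPoly K I d * t.1 f) ∧
      ∀ Q' : Ideal (PolyAlg K n), IsStable I Q' → ∀ f ∈ Q', t.1 f ∈ Q' := by
  obtain ⟨N, hN⟩ : ∃ N, ∀ m : Fin n →₀ ℕ, N ≤ m.degree → coeff m G = 0 := by
    refine ⟨G.totalDegree + 1, fun m hm => coeff_eq_zero_of_totalDegree_lt ?_⟩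
    rw [← Finsupp.degree_apply] 
    omega
  induction N generalizing G with
  | zero =>
    refine absurd ?_ hG
    have : G = 0 := by
      ext m
      simp [hN m]
    simp [this]
  | succ N ih =>
    by_cases h : ∃ j ∉ I, Yop K n j G ∉ Q
    · obtain ⟨j, hj, hjG⟩ := h
      obtain ⟨t, c, h1, h2, h3, h4⟩ := ih hjG fun m hm => by
        rw [coeff_Yop]
        exact hN _ (by simpa using hm)
      refine ⟨t * yS K n j, c, h1, h2, fun d f => ?_, fun Q' hQ' f hf => ?_⟩
      · rw [SnAlg.mul_apply, SnAlg.mul_apply, yS_apply, yS_apply, Yop_inclPoly_mul hj, h3]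
      · exact h4 Q' hQ' _ (hQ' j hj f hf)
    · push Not at h
      have h1 := hQ.sub_epsHom_mem (J := Iᶜ) disjoint_compl_right
        fun j hj => h j (Finset.mem_compl.mp hj)
      refine ⟨eS K Iᶜ, resPoly K I G, (inclPoly_resPoly I G).symm, ?_, fun d f => ?_,
        fun Q' hQ' f hf => hQ'.epsHom_mem' disjoint_compl_right hf⟩
      · rw [inclPoly_resPoly]
        exact fun h2 => hG (by simpa using Q.add_mem h1 h2)
      · rw [eS_apply, eS_apply, map_mul, epsHom_inclPoly disjoint_compl_right]

theorem pairIdeal_isPrime {I : Finset (Fin n)} {Q : Ideal (PolyAlg K n)} (h : IsAdmissible I Q) :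
    tsiPrime (pairIdeal I Q h) := by
  have hp := h.isPrime
  refine tsiPrime_of_forall (fun h1 => ?_) fun a b ha hb => ?_
  · obtain ⟨M, hM⟩ := (mem_pairIdeal h).mp h1
    have := hM M le_rfl 1
    rw [SnAlg.one_apply, mul_one] at this
    exact h.prodX_pow_notMem M this
  · rw [mem_pairIdeal] at ha hb
    push Not at ha hb
    obtain ⟨k, hk⟩ := exists_linFrom I a
    obtain ⟨l, hl⟩ := exists_linFrom I b
    obtain ⟨N, hkN, f, hf⟩ := ha k
    obtain ⟨M, hlM, g, hg⟩ := hb l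
    obtain ⟨t, c, h1, h2, h3, -⟩ := h.stable.exists_apply_eq_inclPoly hg
    refine ⟨mS K n (prodX K I ^ N * f) * t, fun hmem => ?_⟩
    obtain ⟨L, hL⟩ := (mem_pairIdeal h).mp hmem
    have h4 := hL (L + M) (Nat.le_add_right L M) g
    have h5 : prodX K I ^ L = inclPoly K I ((∏ i, X i) ^ L) := by
      rw [map_pow, prodX_eq_inclPoly]
    rw [SnAlg.mul_apply, SnAlg.mul_apply, SnAlg.mul_apply, (hl.mono hlM).prodX_pow_mul, h5, h3, h1,
      mS_apply, ← map_mul, mul_comm, (hk.mono hkN).inclPoly_mul, map_mul, ← h5, mul_assoc] at h4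
    rcases hp.mem_or_mem h4 with h6 | h6
    · exact h.prodX_pow_notMem L h6
    · exact (hp.mem_or_mem h6).elim h2 hf

theorem mS_mem_pairIdeal {I : Finset (Fin n)} {Q : Ideal (PolyAlg K n)} (h : IsAdmissible I Q)
    {f : PolyAlg K n} : mS K n f ∈ pairIdeal I Q h ↔ f ∈ Q := by
  rw [mem_pairIdeal]
  refine ⟨fun ⟨M, hM⟩ => ?_, fun hf => ⟨0, fun N _ g => Q.mul_mem_right _ hf⟩⟩
  have := hM M le_rfl 1
  rw [mS_apply, mul_one] at this
  exact (h.isPrime.mem_or_mem this).resolve_right (h.prodX_pow_notMem M)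

theorem eS_mem_pairIdeal {I : Finset (Fin n)} {Q : Ideal (PolyAlg K n)} (h : IsAdmissible I Q)
    {i : Fin n} : eS K {i} ∈ pairIdeal I Q h ↔ i ∈ I := by
  rw [mem_pairIdeal]
  refine ⟨fun ⟨M, hM⟩ => ?_, fun hi => ⟨1, fun N hN f => ?_⟩⟩
  · by_contra hi
    have := hM M le_rfl 1
    rw [eS_apply, mul_one, prodX_eq_inclPoly, ← map_pow,
      epsHom_inclPoly (Finset.disjoint_singleton_right.mpr hi), map_pow, ← prodX_eq_inclPoly] at this
    exact h.prodX_pow_notMem M this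
  · obtain ⟨N, rfl⟩ := Nat.exists_eq_add_of_le hN
    rw [eS_apply, pow_add, pow_one, prodX, ← Finset.mul_prod_erase I _ hi, mul_assoc, mul_assoc,
      map_mul, epsHom_X, if_pos (Finset.mem_singleton_self i), zero_mul]
    exact Q.zero_mem

theorem pairIdeal_mono {I I' : Finset (Fin n)} {Q Q' : Ideal (PolyAlg K n)}
    (h : IsAdmissible I Q) (h' : IsAdmissible I' Q') (hI : I ⊆ I') (hQ : Q ≤ Q') :
    pairIdeal I Q h ≤ pairIdeal I' Q' h' := by
  intro a ha
  obtain ⟨M, hM⟩ := (mem_pairIdeal h).mp ha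
  refine (mem_pairIdeal h').mpr ⟨M, fun N hN f => hQ ?_⟩
  have : prodX K I' = prodX K I * prodX K (I' \ I) := by
    rw [mul_comm]
    exact (Finset.prod_sdiff hI).symm
  rw [this, mul_pow, mul_assoc]
  exact hM N hN _

section Commutator

variable {R : Type*} [Ring R] {P : TwoSidedIdeal R} {m a b x y c d s : R}

theorem TwoSidedIdeal.commutator_mem_of_commute (h : Commute a b) : a * b - b * a ∈ P := by
  rw [h.eq, sub_self]
  exact P.zero_mem

theorem TwoSidedIdeal.commutator_mem_of_leftInverse (hm : Commute m x) (hyx : y * x = 1)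
    (h : 1 - x * y ∈ P) : m * y - y * m ∈ P := by
  have h1 : m * y - y * m = -(y * m * (1 - x * y)) := by
    rw [mul_sub, mul_one, ← mul_assoc, mul_assoc y, hm.eq, ← mul_assoc, hyx, one_mul, neg_sub]
  rw [h1]
  exact P.neg_mem (P.mul_mem_left _ _ h)

theorem TwoSidedIdeal.commutator_add_mem (ha : m * a - a * m ∈ P) (hb : m * b - b * m ∈ P) :
    m * (a + b) - (a + b) * m ∈ P := by
  rw [mul_add, add_mul, add_sub_add_comm]
  exact P.add_mem ha hb

theorem TwoSidedIdeal.commutator_mul_mem (ha : m * a - a * m ∈ P) (hb : m * b - b * m ∈ P) :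
    m * (a * b) - a * b * m ∈ P := by
  have := P.add_mem (P.mul_mem_right _ b ha) (P.mul_mem_left a _ hb)
  convert this using 1
  noncomm_ring

theorem TwoSidedIdeal.mul_mul_mem_of_commutator_mem (h : c * s - s * c ∈ P) (hcd : c * d ∈ P) :
    c * s * d ∈ P := by
  have := P.add_mem (P.mul_mem_right _ d h) (P.mul_mem_left s _ hcd)
  convert this using 1
  noncomm_ring

theorem TwoSidedIdeal.mem_of_mul_mem_of_one_sub_mul_mem (h : c * x ∈ P) (h' : 1 - x * y ∈ P) :
    c ∈ P := by
  have := P.add_mem (P.mul_mem_right _ y h) (P.mul_mem_left c _ h')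
  convert this using 1
  noncomm_ring

theorem TwoSidedIdeal.mem_of_eq_add (h : a = b + c) (ha : a ∈ P) (hc : c ∈ P) : b ∈ P := by
  rw [eq_sub_of_add_eq h.symm]
  exact P.sub_mem ha hc

end Commutator

theorem isStable_map_inclPoly (I : Finset (Fin n)) (q : Ideal (MvPolynomial {i // i ∈ I} K)) :
    IsStable I (q.map (inclPoly K I)) := by
  intro j hj f hf
  refine Submodule.span_induction (p := fun f _ => Yop K n j f ∈ q.map (inclPoly K I))
    ?_ ?_ ?_ ?_ hf
  · rintro _ ⟨c, hc, rfl⟩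
    have := Yop_inclPoly_mul hj c 1
    rw [mul_one] at this
    change Yop K n j (inclPoly K I c) ∈ _
    rw [this]
    exact Ideal.mul_mem_right _ _ (Ideal.mem_map_of_mem _ hc)
  · rw [map_zero]
    exact zero_mem _
  · intro f g _ _ hf hg
    rw [map_add]
    exact add_mem hf hg
  · intro a f hf' hf
    rw [smul_eq_mul, Yop_mul]
    exact add_mem (Ideal.mul_mem_left _ _ hf') (Ideal.mul_mem_left _ _ hf)

theorem IsStable.map_comap {I : Finset (Fin n)} {Q : Ideal (PolyAlg K n)} (hQ : IsStable I Q) :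
    (Q.comap (inclPoly K I)).map (inclPoly K I) = Q := by
  refine le_antisymm Ideal.map_comap_le fun G hG => ?_
  by_contra hG'
  obtain ⟨t, c, h1, h2, -, h4⟩ := (isStable_map_inclPoly I _).exists_apply_eq_inclPoly hG'
  refine h2 (Ideal.mem_map_of_mem _ ?_)
  rw [Ideal.mem_comap, ← h1]
  exact h4 Q hQ G hG

theorem xS_commute_xS (i j : Fin n) : Commute (xS K n i) (xS K n j) :=
  SnAlg.ext fun f => mul_left_comm (X i) (X j) f

theorem yS_commute_yS (i j : Fin n) : Commute (yS K n i) (yS K n j) :=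
  SnAlg.ext fun f => Yop_comm_Yop i j f

theorem yS_commute_xS {i j : Fin n} (h : i ≠ j) : Commute (yS K n i) (xS K n j) :=
  SnAlg.ext fun f => Yop_X_mul_of_ne h.symm f

theorem mS_commute_xS (f : PolyAlg K n) (j : Fin n) : Commute (mS K n f) (xS K n j) := by
  rw [xS_eq]
  exact (Commute.all f (X j)).map (mS K n)

theorem mS_inclPoly_commute_yS {I : Finset (Fin n)} {j : Fin n} (hj : j ∉ I)
    (c : MvPolynomial {i // i ∈ I} K) : Commute (mS K n (inclPoly K I c)) (yS K n j) :=
  SnAlg.ext fun f => (Yop_inclPoly_mul hj c f).symm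

theorem eS_commute_xS {J : Finset (Fin n)} {j : Fin n} (hj : j ∉ J) :
    Commute (eS K J) (xS K n j) := by
  rw [xS_eq, Commute, SemiconjBy, eS_mul_mS, epsHom_X, if_neg hj]

theorem eS_commute_yS {J : Finset (Fin n)} {j : Fin n} (hj : j ∉ J) :
    Commute (eS K J) (yS K n j) := by
  induction J using Finset.induction_on with
  | empty => rw [eS_empty]; exact Commute.one_left _
  | insert i J _ ih =>
    rw [Finset.mem_insert, not_or] at hj
    rw [eS_insert]
    refine Commute.mul_left ?_ (ih hj.2)
    exact SnAlg.ext fun f => (Yop_epsHom_of_ne (Ne.symm hj.1) f).symm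

/-- If `a` commutes with `x_k, y_k` for `k ∉ J` and `b` commutes with `x_k, y_k` for `k ∈ J`,
then `ab` in a prime ideal forces `a` or `b` to be there. -/
theorem tsiPrime.mem_or_mem_of_commute {P : TwoSidedIdeal (SnAlg K n)} (hP : tsiPrime P)
    {J : Finset (Fin n)} {a b : SnAlg K n}
    (ha : ∀ k ∉ J, Commute a (xS K n k) ∧ Commute a (yS K n k))
    (hb : ∀ k ∈ J, Commute b (xS K n k) ∧ Commute b (yS K n k))
    (hab : a * b ∈ P) : a ∈ P ∨ b ∈ P := by
  let D : SnAlg K n → Prop := fun d =>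
    Commute d b ∧ ∀ k ∉ J, Commute d (xS K n k) ∧ Commute d (yS K n k)
  let W : SnAlg K n → Prop := fun w => ∀ d, D d → a * d * w * b ∈ P
  have hDmul : ∀ d e, D d → D e → D (d * e) := fun d e hd he =>
    ⟨hd.1.mul_left he.1, fun k hk =>
      ⟨(hd.2 k hk).1.mul_left (he.2 k hk).1, (hd.2 k hk).2.mul_left (he.2 k hk).2⟩⟩
  have hin : ∀ g, D g → ∀ w, W w → W (g * w) := fun g hg w hw d hd => by
    have := hw (d * g) (hDmul d g hd hg)
    simpa only [mul_assoc] using this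
  have hout : ∀ g, (∀ d, D d → Commute d g) → Commute a g → ∀ w, W w → W (g * w) :=
    fun g hg hag w hw d hd => by
      have : a * d * (g * w) * b = g * (a * d * w * b) := by
        rw [← mul_assoc (a * d), (hag.mul_left (hg d hd)).eq]
        simp only [mul_assoc]
      rw [this]
      exact P.mul_mem_left _ _ (hw d hd)
  have key : ∀ s w, W w → W (s * w) := by
    intro s
    induction s using SnAlg.induction with
    | hx i =>
      by_cases hi : i ∈ J
      · exact hin _ ⟨(hb i hi).1.symm, fun k hk =>
          ⟨xS_commute_xS i k, (yS_commute_xS (fun h : k = i => hk (h ▸ hi))).symm⟩⟩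
      · exact hout _ (fun d hd => (hd.2 i hi).1) (ha i hi).1
    | hy i =>
      by_cases hi : i ∈ J
      · exact hin _ ⟨(hb i hi).2.symm, fun k hk =>
          ⟨yS_commute_xS (fun h : i = k => hk (h ▸ hi)), yS_commute_yS i k⟩⟩
      · exact hout _ (fun d hd => (hd.2 i hi).2) (ha i hi).2
    | hc c => exact hout _ (fun d _ => (Algebra.commutes c d).symm) (Algebra.commutes c a).symm
    | hadd s t hs ht =>
      intro w hw d hd
      rw [add_mul, mul_add, add_mul]
      exact P.add_mem (hs w hw d hd) (ht w hw d hd)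
    | hmul s t hs ht =>
      intro w hw
      rw [mul_assoc]
      exact hs _ (ht w hw)
  refine hP.mem_or_mem fun s => ?_
  have h1 : W 1 := fun d hd => by
    rw [mul_one, mul_assoc, hd.1.eq, ← mul_assoc]
    exact P.mul_mem_right _ _ hab
  have := key s 1 h1 1 ⟨Commute.one_left _, fun k _ => ⟨Commute.one_left _, Commute.one_left _⟩⟩
  simpa using this

open Classical in
/-- The set of the `i` with `e_i ∈ P`. -/
def idxSet (P : TwoSidedIdeal (SnAlg K n)) : Finset (Fin n) :=
  Finset.univ.filter fun i => eS K {i} ∈ P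

theorem mem_idxSet {P : TwoSidedIdeal (SnAlg K n)} {i : Fin n} :
    i ∈ idxSet P ↔ eS K {i} ∈ P := by
  simp [idxSet]

/-- The intersection of `P` with the polynomial ring. -/
def polyIdeal (P : TwoSidedIdeal (SnAlg K n)) : Ideal (PolyAlg K n) where
  carrier := {f | mS K n f ∈ P}
  add_mem' {f g} hf hg := by
    rw [Set.mem_ofPred_eq, map_add]
    exact P.add_mem hf hg
  zero_mem' := by
    rw [Set.mem_ofPred_eq, map_zero]
    exact P.zero_mem
  smul_mem' f g hg := by
    rw [Set.mem_ofPred_eq, smul_eq_mul, map_mul]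
    exact P.mul_mem_left _ _ hg

theorem mem_polyIdeal {P : TwoSidedIdeal (SnAlg K n)} {f : PolyAlg K n} :
    f ∈ polyIdeal P ↔ mS K n f ∈ P := Iff.rfl

section Prime

variable {P : TwoSidedIdeal (SnAlg K n)} (hP : tsiPrime P)
include hP

theorem tsiPrime.eS_notMem {J : Finset (Fin n)} (hJ : Disjoint (idxSet P) J) : eS K J ∉ P := by
  induction J using Finset.induction_on with
  | empty =>
    rw [eS_empty]
    exact hP.one_notMem
  | insert j J hj ih =>
    rw [Finset.disjoint_insert_right] at hJ
    rw [eS_insert]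
    intro h
    rcases hP.mem_or_mem_of_commute (J := {j})
      (fun k hk => ⟨eS_commute_xS hk, eS_commute_yS hk⟩)
      (fun k hk => by
        obtain rfl := Finset.mem_singleton.mp hk
        exact ⟨eS_commute_xS hj, eS_commute_yS hj⟩) h with h | h
    · exact hJ.1 (mem_idxSet.mpr h)
    · exact ih hJ.2 h

theorem tsiPrime.epsHom_mem_polyIdeal {J : Finset (Fin n)} (hJ : Disjoint (idxSet P) J)
    {f : PolyAlg K n} (h : mS K n (epsHom K J f) * eS K J ∈ P) :
    epsHom K J f ∈ polyIdeal P := by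
  have h1 : epsHom K J f = inclPoly K Jᶜ (resPoly K Jᶜ f) := by
    rw [inclPoly_resPoly, compl_compl]
  refine (hP.mem_or_mem_of_commute (J := Jᶜ) (fun k hk => ⟨mS_commute_xS _ _, ?_⟩)
    (fun k hk => ?_) h).resolve_right (hP.eS_notMem hJ)
  · rw [h1]
    exact mS_inclPoly_commute_yS hk _
  · rw [Finset.mem_compl] at hk
    exact ⟨eS_commute_xS hk, eS_commute_yS hk⟩

theorem tsiPrime.isStable : IsStable (idxSet P) (polyIdeal P) := by
  intro j hj f hf
  have h1 : epsHom K {j} f ∈ polyIdeal P := by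
    refine hP.epsHom_mem_polyIdeal (Finset.disjoint_singleton_right.mpr hj) ?_
    rw [← eS_mul_mS]
    exact P.mul_mem_left _ _ hf
  exact TwoSidedIdeal.mem_of_eq_add (yS_mul_mS j f) (P.mul_mem_left _ _ hf)
    (P.mul_mem_right _ _ h1)

omit hP in
theorem mS_inclPoly_central (c : MvPolynomial {i // i ∈ idxSet P} K) (s : SnAlg K n) :
    mS K n (inclPoly K _ c) * s - s * mS K n (inclPoly K _ c) ∈ P := by
  induction s using SnAlg.induction with
  | hx i => exact TwoSidedIdeal.commutator_mem_of_commute (mS_commute_xS _ i)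
  | hy i =>
    by_cases hi : i ∈ idxSet P
    · exact TwoSidedIdeal.commutator_mem_of_leftInverse (mS_commute_xS _ i) (yS_mul_xS i)
        (eS_singleton (K := K) i ▸ mem_idxSet.mp hi)
    · exact TwoSidedIdeal.commutator_mem_of_commute (mS_inclPoly_commute_yS hi c)
  | hc k => exact TwoSidedIdeal.commutator_mem_of_commute (Algebra.commutes k _).symm
  | hadd a b ha hb => exact TwoSidedIdeal.commutator_add_mem ha hb
  | hmul a b ha hb => exact TwoSidedIdeal.commutator_mul_mem ha hb

theorem tsiPrime.isPrime_comap_polyIdeal :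
    ((polyIdeal P).comap (inclPoly K (idxSet P))).IsPrime := by
  refine ⟨fun h => ?_, fun {c d} hcd => ?_⟩
  · rw [Ideal.eq_top_iff_one, Ideal.mem_comap, map_one, mem_polyIdeal, map_one] at h
    exact hP.one_notMem h
  · refine hP.mem_or_mem fun s => ?_
    rw [Ideal.mem_comap, map_mul, mem_polyIdeal, map_mul] at hcd
    exact TwoSidedIdeal.mul_mul_mem_of_commutator_mem (mS_inclPoly_central c s) hcd

theorem tsiPrime.isAdmissible : IsAdmissible (idxSet P) (polyIdeal P) where
  isPrime := by
    have := hP.isPrime_comap_polyIdeal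
    rw [← hP.isStable.map_comap]
    exact isPrime_map_inclPoly _ _
  notMem i _ h := hP.one_notMem (yS_mul_xS (K := K) i ▸ P.mul_mem_left _ _ h)
  stable := hP.isStable

theorem tsiPrime.mem_polyIdeal_of_mul_eS_mem {f : PolyAlg K n}
    (h : mS K n f * eS K (idxSet P)ᶜ ∈ P) : f ∈ polyIdeal P := by
  by_contra hf
  obtain ⟨t, c, h1, h2, h3, -⟩ := hP.isStable.exists_apply_eq_inclPoly hf
  apply h2
  have h4 : epsHom K (idxSet P)ᶜ (inclPoly K (idxSet P) c) = inclPoly K (idxSet P) c :=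
    epsHom_inclPoly disjoint_compl_right c
  rw [← h4]
  apply hP.epsHom_mem_polyIdeal disjoint_compl_right
  have h5 : t * (mS K n f * eS K (idxSet P)ᶜ) =
      mS K n (inclPoly K (idxSet P) c) * eS K (idxSet P)ᶜ := SnAlg.ext fun g => by
    rw [SnAlg.mul_apply, SnAlg.mul_apply, SnAlg.mul_apply, eS_apply, mS_apply, mS_apply,
      ← inclPoly_resPoly, mul_comm, h3, h1, mul_comm]
  rw [h4, ← h5]
  exact P.mul_mem_left _ _ h

omit hP in
theorem mem_of_mul_prodX_mem {J : Finset (Fin n)} (hJ : J ⊆ idxSet P) {c : SnAlg K n}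
    (h : c * mS K n (prodX K J) ∈ P) : c ∈ P := by
  induction J using Finset.induction_on generalizing c with
  | empty => simpa [prodX] using h
  | insert j J hj ih =>
    rw [Finset.insert_subset_iff] at hJ
    rw [prodX, Finset.prod_insert hj, map_mul, ← mul_assoc] at h
    exact TwoSidedIdeal.mem_of_mul_mem_of_one_sub_mul_mem (ih hJ.2 h)
      (eS_singleton (K := K) j ▸ mem_idxSet.mp hJ.1)

omit hP in
theorem mem_of_mul_prodX_pow_mem (N : ℕ) {c : SnAlg K n}
    (h : c * mS K n (prodX K (idxSet P) ^ N) ∈ P) : c ∈ P := by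
  induction N generalizing c with
  | zero => simpa using h
  | succ N ih =>
    rw [pow_succ, map_mul, ← mul_assoc] at h
    exact ih (mem_of_mul_prodX_mem subset_rfl h)

omit hP in
theorem LinFrom.mul_mS_mul_eS {I : Finset (Fin n)} {a : SnAlg K n} {k : ℕ} (h : LinFrom I a k)
    (f : PolyAlg K n) : a * (mS K n (prodX K I ^ k * f) * eS K Iᶜ) =
      mS K n (a.1 (prodX K I ^ k * f)) * eS K Iᶜ := SnAlg.ext fun g => by
  rw [SnAlg.mul_apply, SnAlg.mul_apply, SnAlg.mul_apply, eS_apply, mS_apply, mS_apply,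
    ← inclPoly_resPoly, mul_comm, h.inclPoly_mul, mul_comm]

theorem tsiPrime.eq_pairIdeal : P = pairIdeal (idxSet P) (polyIdeal P) hP.isAdmissible := by
  refine le_antisymm (fun a ha => ?_) (fun a ha => ?_)
  · obtain ⟨k, hk⟩ := exists_linFrom (idxSet P) a
    refine (mem_pairIdeal _).mpr ⟨k, fun N hN f => ?_⟩
    apply hP.mem_polyIdeal_of_mul_eS_mem
    rw [← (hk.mono hN).mul_mS_mul_eS]
    exact P.mul_mem_right _ _ ha
  · refine (hP.mem_or_mem (b := eS K (idxSet P)ᶜ) fun s => ?_).resolve_right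
      (hP.eS_notMem disjoint_compl_right)
    obtain ⟨M, hM⟩ := (mem_pairIdeal _).mp (TwoSidedIdeal.mul_mem_right _ a s ha)
    obtain ⟨k, hk⟩ := exists_linFrom (idxSet P) (a * s)
    refine mem_of_mul_prodX_pow_mem (M + k) ?_
    have h1 := (hk.mono (Nat.le_add_left k M)).mul_mS_mul_eS 1
    have h2 : mS K n (prodX K (idxSet P) ^ (M + k)) * eS K (idxSet P)ᶜ =
        eS K (idxSet P)ᶜ * mS K n (prodX K (idxSet P) ^ (M + k)) := by
      rw [eS_mul_mS, prodX_eq_inclPoly, ← map_pow, epsHom_inclPoly disjoint_compl_right]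
    rw [mul_one, h2, ← mul_assoc] at h1
    rw [h1]
    refine P.mul_mem_right _ _ ?_
    have := hM (M + k) (Nat.le_add_right M k) 1
    rwa [mul_one] at this

end Prime

theorem isAdmissible_map_inclPoly {I : Finset (Fin n)} {Q : Ideal (PolyAlg K n)}
    (h : IsAdmissible I Q) {q : Ideal (MvPolynomial {i // i ∈ I} K)} [q.IsPrime]
    (hq : q ≤ Q.comap (inclPoly K I)) : IsAdmissible I (q.map (inclPoly K I)) where
  isPrime := isPrime_map_inclPoly I q
  notMem i hi h' := h.notMem i hi (Ideal.map_le_iff_le_comap.mpr hq h')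
  stable := isStable_map_inclPoly I q

theorem isAdmissible_bot (I : Finset (Fin n)) : IsAdmissible I (⊥ : Ideal (PolyAlg K n)) where
  isPrime := Ideal.isPrime_bot
  notMem i _ h := X_ne_zero i h
  stable j _ f hf := by
    rw [Ideal.mem_bot] at hf ⊢
    rw [hf, map_zero]

theorem IsAdmissible.X_notMem {I : Finset (Fin n)} {Q : Ideal (PolyAlg K n)}
    (h : IsAdmissible I Q) (i : Fin n) : X i ∉ Q := by
  by_cases hi : i ∈ I
  · exact h.notMem i hi
  · intro hX
    have := h.stable i hi _ hX
    rw [← mul_one (X i), Yop_X_mul] at this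
    exact h.isPrime.one_notMem this

theorem IsAdmissible.mono {I J : Finset (Fin n)} {Q : Ideal (PolyAlg K n)}
    (h : IsAdmissible I Q) (hIJ : I ⊆ J) : IsAdmissible J Q where
  isPrime := h.isPrime
  notMem i _ := h.X_notMem i
  stable j hj := h.stable j fun hj' => hj (hIJ hj')

/-- The poset of pairs `(I, Q)` which parametrizes the prime ideals of `S_n`. -/
abbrev AdmPair (K : Type u) [Field K] (n : ℕ) :=
  {p : Finset (Fin n) × Ideal (PolyAlg K n) // IsAdmissible p.1 p.2}

theorem pairIdeal_le_iff {I I' : Finset (Fin n)} {Q Q' : Ideal (PolyAlg K n)}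
    (h : IsAdmissible I Q) (h' : IsAdmissible I' Q') :
    pairIdeal I Q h ≤ pairIdeal I' Q' h' ↔ I ⊆ I' ∧ Q ≤ Q' := by
  refine ⟨fun hle => ⟨fun i hi => ?_, fun f hf => ?_⟩, fun hle => pairIdeal_mono h h' hle.1 hle.2⟩
  · exact (eS_mem_pairIdeal h').mp (hle ((eS_mem_pairIdeal h).mpr hi))
  · exact (mS_mem_pairIdeal h').mp (hle ((mS_mem_pairIdeal h).mpr hf))

/-- The bijection between admissible pairs and prime ideals of `S_n`. -/
def pairEquiv (K : Type u) [Field K] (n : ℕ) :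
    AdmPair K n ≃o {P : TwoSidedIdeal (SnAlg K n) // tsiPrime P} :=
  RelIso.ofSurjective
    (OrderEmbedding.ofMapLEIff
      (fun p : AdmPair K n => (⟨pairIdeal p.1.1 p.1.2 p.2, pairIdeal_isPrime p.2⟩ :
        {P : TwoSidedIdeal (SnAlg K n) // tsiPrime P}))
      fun p p' => pairIdeal_le_iff p.2 p'.2)
    fun P => ⟨⟨(idxSet P.1, polyIdeal P.1), P.2.isAdmissible⟩, Subtype.ext P.2.eq_pairIdeal.symm⟩

namespace AdmPair

/-- The number which turns out to be the height of the corresponding prime ideal. -/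
def rank (p : AdmPair K n) : ℕ := p.1.1.card + p.1.2.height.toNat

theorem height_le (p : AdmPair K n) : p.1.2.height ≤ n := by
  have h := Ideal.height_le_ringKrullDim_of_ne_top p.2.isPrime.ne_top
  rw [MvPolynomial.ringKrullDim_of_isNoetherianRing, ringKrullDim_eq_zero_of_field, zero_add,
    Nat.card_eq_fintype_card, Fintype.card_fin] at h
  exact_mod_cast h

theorem coe_rank (p : AdmPair K n) : (p.rank : ℕ∞) = p.1.1.card + p.1.2.height := by
  rw [rank, Nat.cast_add,
    ENat.natCast_toNat (ne_top_of_le_ne_top (ENat.natCast_ne_top n) p.height_le)]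

theorem rank_le (p : AdmPair K n) : p.rank ≤ 2 * n := by
  have h1 : p.1.1.card ≤ n := by simpa using p.1.1.card_le_univ
  have h2 : p.1.2.height.toNat ≤ n := ENat.toNat_le_of_le_natCast p.height_le
  rw [rank]
  lia

theorem rank_strictMono : StrictMono (rank : AdmPair K n → ℕ) := by
  intro p p' h
  have hI : p.1.1 ⊆ p'.1.1 := h.le.1
  have hQ : p.1.2 ≤ p'.1.2 := h.le.2
  have := p.2.isPrime
  have := p'.2.isPrime
  have h1 := coe_rank p
  have h2 := coe_rank p'
  rw [← Nat.cast_lt (α := ℕ∞), h1, h2]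
  have ht : p.1.2.height ≠ ⊤ := ne_top_of_le_ne_top (ENat.natCast_ne_top n) p.height_le
  rcases hQ.eq_or_lt with h3 | h3
  · have h4 : p.1.1 ⊂ p'.1.1 := hI.ssubset_of_ne fun h4 => h.ne (Subtype.ext (Prod.ext h4 h3))
    rw [h3] at ht ⊢
    exact (ENat.add_lt_add_iff_right ht).mpr (Nat.cast_lt.mpr (Finset.card_lt_card h4))
  · have h4 : (p.1.1.card : ℕ∞) ≤ p'.1.1.card := Nat.cast_le.mpr (Finset.card_le_card hI)
    have h5 := Ideal.height_add_one_le_of_lt_of_isPrime h3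
    rw [← ENat.add_one_le_iff (by rw [← h1]; exact ENat.natCast_ne_top _), add_assoc]
    exact add_le_add h4 h5

theorem card_le_height_bot (I : Finset (Fin n)) :
    (I.card : ℕ∞) ≤ Order.height (⟨(I, ⊥), isAdmissible_bot I⟩ : AdmPair K n) := by
  induction I using Finset.induction_on with
  | empty => simp
  | insert i I hi ih =>
    rw [Finset.card_insert_of_notMem hi, Nat.cast_add, Nat.cast_one]
    refine (add_le_add_left ih 1).trans (Order.height_add_one_le ?_)
    exact Subtype.mk_lt_mk.mpr (Prod.mk_lt_mk_of_lt_of_le (Finset.ssubset_insert hi) le_rfl)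

theorem rank_le_height (p : AdmPair K n) : (p.rank : ℕ∞) ≤ Order.height p := by
  obtain ⟨⟨I, Q⟩, h⟩ := p
  have hQ : Q.IsPrime := h.isPrime
  rw [coe_rank]
  change (I.card : ℕ∞) + Q.height ≤ _
  set q := Q.comap (inclPoly K I)
  have hqQ : q.map (inclPoly K I) = Q := h.stable.map_comap
  have hqp : q.IsPrime := Ideal.comap_isPrime _ _
  obtain ⟨s, hs, hlen⟩ := q.exists_ltSeries_length_eq_height
  have hle (k : Fin (s.length + 1)) : (s k).asIdeal ≤ q := by
    have h1 : s k ≤ s.last := s.monotone (Fin.le_last k)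
    rw [hs] at h1
    exact h1
  let t (k : Fin (s.length + 1)) : AdmPair K n :=
    ⟨(I, (s k).asIdeal.map (inclPoly K I)), isAdmissible_map_inclPoly h (hle k)⟩
  have ht : StrictMono t := fun k l hkl => by
    have h1 : (s k).asIdeal < (s l).asIdeal := s.strictMono hkl
    refine lt_of_le_not_ge ⟨le_rfl, Ideal.map_mono h1.le⟩ fun h2 => h1.not_ge ?_
    have h3 := Ideal.comap_mono (f := inclPoly K I) h2.2
    rwa [comap_map_inclPoly, comap_map_inclPoly] at h3
  have key (k : Fin (s.length + 1)) : (I.card : ℕ∞) + (k : ℕ) ≤ Order.height (t k) := by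
    induction k using Fin.induction with
    | zero =>
      simp only [Fin.val_zero, Nat.cast_zero, add_zero]
      exact (card_le_height_bot I).trans (Order.height_mono ⟨le_rfl, bot_le⟩)
    | succ k ih =>
      rw [Fin.val_succ, Nat.cast_add, Nat.cast_one, ← add_assoc]
      exact (add_le_add_left ih 1).trans (Order.height_add_one_le (ht k.castSucc_lt_succ))
  have h1 := key (Fin.last _)
  have h2 : t (Fin.last _) = ⟨(I, Q), h⟩ := by
    refine Subtype.ext (Prod.ext rfl ?_)
    change Ideal.map (inclPoly K I) s.last.asIdeal = Q
    rw [hs, hqQ]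
  rw [h2, Fin.val_last, hlen] at h1
  have h3 : Q.height = q.height := by rw [← hqQ, height_map_inclPoly]
  rwa [h3]

theorem height_add_coheight_univ {Q : Ideal (PolyAlg K n)} (h : IsAdmissible Finset.univ Q) :
    (n : ℕ∞) ≤ Order.coheight (⟨(Finset.univ, Q), h⟩ : AdmPair K n) + Q.height := by
  have hQ := h.isPrime
  obtain ⟨s, h1, h2, h3⟩ := exists_ltSeries_notMem Q (h.prodX_pow_notMem 1)
  refine h3.trans (add_le_add_left ?_ _)
  let t : LTSeries (AdmPair K n) := LTSeries.mk s.length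
    (fun k => ⟨(Finset.univ, (s k).asIdeal), (s k).isPrime, fun i hi hX => h2 <| by
      have h4 : (s k).asIdeal ≤ s.last.asIdeal := s.monotone (Fin.le_last k)
      rw [pow_one, prodX]
      exact Ideal.mem_of_dvd _ (Finset.dvd_prod_of_mem _ hi) (h4 hX),
      fun j hj => absurd (Finset.mem_univ j) hj⟩)
    fun k l hkl => Subtype.mk_lt_mk.mpr (Prod.mk_lt_mk_of_le_of_lt le_rfl (s.strictMono hkl))
  refine Order.length_le_coheight (p := t) ⟨le_rfl, ?_⟩
  exact h1.ge

theorem card_compl_add_coheight {I : Finset (Fin n)} {Q : Ideal (PolyAlg K n)}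
    (h : IsAdmissible I Q) (J : Finset (Fin n)) (hIJ : Disjoint J I) :
    Order.coheight (⟨(J ∪ I, Q), h.mono Finset.subset_union_right⟩ : AdmPair K n) + J.card ≤
      Order.coheight (⟨(I, Q), h⟩ : AdmPair K n) := by
  induction J using Finset.induction_on with
  | empty => simp
  | insert j J hj ih =>
    rw [Finset.disjoint_insert_left] at hIJ
    rw [Finset.card_insert_of_notMem hj, Nat.cast_add, Nat.cast_one, add_comm (J.card : ℕ∞),
      ← add_assoc]
    refine le_trans (add_le_add_left (Order.coheight_add_one_le ?_) _) (ih hIJ.2)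
    refine Subtype.mk_lt_mk.mpr (Prod.mk_lt_mk_of_lt_of_le ?_ le_rfl)
    rw [Finset.insert_union]
    exact Finset.ssubset_insert (by simp [hj, hIJ.1])

theorem sub_rank_le_coheight (p : AdmPair K n) :
    ((2 * n - p.rank : ℕ) : ℕ∞) ≤ Order.coheight p := by
  obtain ⟨⟨I, Q⟩, h⟩ := p
  have h1 := card_compl_add_coheight h Iᶜ disjoint_compl_left
  have h2 := height_add_coheight_univ (h.mono (Finset.subset_univ I))
  have h3 : (⟨(Iᶜ ∪ I, Q), h.mono Finset.subset_union_right⟩ : AdmPair K n) =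
      ⟨(Finset.univ, Q), h.mono (Finset.subset_univ I)⟩ :=
    Subtype.ext (Prod.ext ((sup_comm _ _).trans sup_compl_eq_top) rfl)
  rw [h3] at h1
  have h4 := coe_rank ⟨(I, Q), h⟩
  have h5 : I.card + Iᶜ.card = n := by simp
  rw [ENat.natCast_sub, tsub_le_iff_right, h4]
  calc ((2 * n : ℕ) : ℕ∞) = n + (I.card + Iᶜ.card : ℕ) := by rw [h5, two_mul, Nat.cast_add]
    _ ≤ (_ + Q.height) + (I.card + Iᶜ.card : ℕ) := add_le_add_left h2 _
    _ = (_ + (Iᶜ.card : ℕ∞)) + (I.card + Q.height) := by rw [Nat.cast_add]; ring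
    _ ≤ _ := add_le_add_left h1 _

end AdmPair

theorem add_le_of_strictMono {m : ℕ} {f : Fin (m + 1) → ℕ} (hf : StrictMono f) :
    f 0 + m ≤ f (Fin.last m) := by
  have key (k : Fin (m + 1)) : f 0 + k ≤ f k := by
    induction k using Fin.induction with
    | zero => simp
    | succ k ih =>
      have := hf k.castSucc_lt_succ
      simp only [Fin.val_castSucc, Fin.val_succ] at ih ⊢
      lia
  exact key (Fin.last m)

theorem primeChainTo_of_le_height {R : Type*} [Ring R] (P : {P : TwoSidedIdeal R // tsiPrime P})
    {m : ℕ} (h : m ≤ Order.height P) : primeChainTo P.1 m := by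
  obtain ⟨s, hs, rfl⟩ := Order.exists_series_of_le_height P h
  exact ⟨fun k => (s k).1, fun k l hkl => s.strictMono hkl, fun k => (s k).2,
    congrArg Subtype.val hs⟩

theorem primeChainFrom_of_le_coheight {R : Type*} [Ring R]
    (P : {P : TwoSidedIdeal R // tsiPrime P}) {m : ℕ} (h : m ≤ Order.coheight P) :
    primeChainFrom P.1 m := by
  obtain ⟨s, hs, rfl⟩ := Order.exists_series_of_le_coheight P h
  exact ⟨fun k => (s k).1, fun k l hkl => s.strictMono hkl, fun k => (s k).2,
    congrArg Subtype.val hs⟩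

/-- The rank of the admissible pair attached to a prime ideal. -/
def primeRank (P : {P : TwoSidedIdeal (SnAlg K n) // tsiPrime P}) : ℕ :=
  ((pairEquiv K n).symm P).rank

theorem primeRank_le (P : {P : TwoSidedIdeal (SnAlg K n) // tsiPrime P}) : primeRank P ≤ 2 * n :=
  AdmPair.rank_le _

theorem primeRank_add_le {m : ℕ} {f : Fin (m + 1) → TwoSidedIdeal (SnAlg K n)}
    (hf : StrictMono f) (hp : ∀ i, tsiPrime (f i)) :
    primeRank ⟨f 0, hp 0⟩ + m ≤ primeRank ⟨f (Fin.last m), hp _⟩ :=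
  add_le_of_strictMono (f := fun k => primeRank ⟨f k, hp k⟩) fun _ _ hkl =>
    AdmPair.rank_strictMono ((pairEquiv K n).symm.strictMono (hf hkl))

theorem heightIs_primeRank (P : {P : TwoSidedIdeal (SnAlg K n) // tsiPrime P}) :
    heightIs P.1 (primeRank P) := by
  refine ⟨primeChainTo_of_le_height P ?_, ?_⟩
  · rw [← Order.height_orderIso (pairEquiv K n).symm]
    exact AdmPair.rank_le_height _
  · rintro m ⟨f, hf, hp, hP⟩
    have h1 := primeRank_add_le hf hp
    have h2 : (⟨f (Fin.last m), hp _⟩ : {P : TwoSidedIdeal (SnAlg K n) // tsiPrime P}) = P :=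
      Subtype.ext hP
    rw [h2] at h1
    lia

theorem coheightIs_sub_primeRank (P : {P : TwoSidedIdeal (SnAlg K n) // tsiPrime P}) :
    coheightIs P.1 (2 * n - primeRank P) := by
  refine ⟨primeChainFrom_of_le_coheight P ?_, ?_⟩
  · rw [← Order.coheight_orderIso (pairEquiv K n).symm]
    exact AdmPair.sub_rank_le_coheight _
  · rintro m ⟨f, hf, hp, hP⟩
    have h1 := (primeRank_add_le hf hp).trans (primeRank_le _)
    have h2 : (⟨f 0, hp 0⟩ : {P : TwoSidedIdeal (SnAlg K n) // tsiPrime P}) = P :=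
      Subtype.ext hP
    rw [h2] at h1
    lia

theorem exists_primeChain : ∃ f : Fin (2 * n + 1) → TwoSidedIdeal (SnAlg K n),
    StrictMono f ∧ ∀ i, tsiPrime (f i) := by
  have h := (coheightIs_sub_primeRank
    (pairEquiv K n ⟨(∅, ⊥), isAdmissible_bot ∅⟩)).1
  rw [primeRank, OrderIso.symm_apply_apply, AdmPair.rank] at h
  simp only [Finset.card_empty, Ideal.height_bot, ENat.toNat_zero, add_zero, Nat.sub_zero] at h
  obtain ⟨f, hf, hp, -⟩ := h
  exact ⟨f, hf, hp⟩

end Proof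

/-- for every prime two-sided ideal `P` of `S_n`,
`ht(P) + cht(P) = cl.Kdim(S_n) = 2n`. -/
theorem statement8 (K : Type u) [Field K] (n : ℕ) (hn : 0 < n) :
    ((∃ f : Fin (2 * n + 1) → TwoSidedIdeal (SnAlg K n),
      StrictMono f ∧ ∀ i, tsiPrime (f i)) ∧
     (∀ (m : ℕ) (f : Fin (m + 1) → TwoSidedIdeal (SnAlg K n)),
      StrictMono f → (∀ i, tsiPrime (f i)) → m ≤ 2 * n)) ∧
    ∀ P : TwoSidedIdeal (SnAlg K n), tsiPrime P →
      ∃ h c : ℕ, heightIs P h ∧ coheightIs P c ∧ h + c = 2 * n := by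
  exact ⟨⟨exists_primeChain, fun m f hf hp =>
    (Nat.le_add_left _ _).trans ((primeRank_add_le hf hp).trans (primeRank_le _))⟩, fun P hP =>
    ⟨_, _, heightIs_primeRank ⟨P, hP⟩, coheightIs_sub_primeRank ⟨P, hP⟩,
      Nat.add_sub_cancel' (primeRank_le _)⟩⟩
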